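/- For the multi-indexed Meixner-Pollaczek polynomial: setting x₀ = -i(a - M/2) and η₀ = x₀, the value at the special point satisfies P_{D,n}(η₀) = c^P_{D,n} · e^{iφ(ℓ_D - n)} · ((2a)_n / (2 sin φ)^{ℓ_D + n}) · ∏_{j=1}^{M} ((1-2a)_{d_j}/(1-2a)_{j-1}) · ∏_{j=1}^{M} (d_j+1-2a)/(d_j+1-n-2a), where 0 ≤ d₁ < ⋯ < d_M, ℓ_D = Σ d_j − M(M−1)/2, and c^P_{D,n} is the leading coefficient of P_{D,n}. -/

import Mathlib

open Finset

/-- Pochhammer symbol `(z)_n` in `ℂ`. -/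
noncomputable def poch (z : ℂ) (n : ℕ) : ℂ := (ascPochhammer ℂ n).eval z

/-- The Meixner-Pollaczek polynomial
`P_n^{(a)}(x;φ) = ((2a)_n/n!) e^{inφ} · ₂F₁(-n, a+ix; 2a; 1-e^{-2iφ})`. -/
noncomputable def MP (a φ : ℝ) (n : ℕ) (x : ℂ) : ℂ :=
  poch (2 * (a : ℂ)) n / (n.factorial : ℂ) * Complex.exp ((n : ℂ) * (φ : ℂ) * Complex.I) *
    ∑ k ∈ Finset.range (n + 1),
      poch (-(n : ℂ)) k * poch ((a : ℂ) + Complex.I * x) k /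
        (poch (2 * (a : ℂ)) k * (k.factorial : ℂ)) *
        (1 - Complex.exp (-(2 * (φ : ℂ) * Complex.I))) ^ k


/-- Shifted coordinate `x_j^{(m)} = x + i((m+1)/2 − j)` (with `j` 1-based). -/
noncomputable def xS (x : ℂ) (m j : ℕ) : ℂ :=
  x + Complex.I * (((m : ℂ) + 1) / 2 - (j : ℂ))

/-- `r_j(x_j^{(m)}; λ, m) = (-1)^{j-1} i^{1-m} (a-(m-1)/2+ix)_{j-1} (a-(m-1)/2-ix)_{m-j}`
as a function of the base point `x` (with `j` 1-based). -/
noncomputable def rMP (a : ℝ) (m j : ℕ) (x : ℂ) : ℂ :=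
  (-1) ^ (j - 1) * Complex.I ^ (1 - (m : ℤ)) *
    poch ((a : ℂ) - ((m : ℂ) - 1) / 2 + Complex.I * x) (j - 1) *
    poch ((a : ℂ) - ((m : ℂ) - 1) / 2 - Complex.I * x) (m - j)

/-- The denominator polynomial `Ξ̌_D(x; λ)`, defined through
`i^{M(M-1)/2} det(ξ̌_{d_k}(x_j^{(M)}; λ)) = Ξ̌_D(x; λ)` with
`ξ̌_v(x; λ) = P̌_v(x; 1-a, φ)`. -/
noncomputable def XiD (a φ : ℝ) {M : ℕ} (d : Fin M → ℕ) (x : ℂ) : ℂ :=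
  Complex.I ^ (M * (M - 1) / 2) *
    Matrix.det (Matrix.of fun j k : Fin M => MP (1 - a) φ (d k) (xS x M ((j : ℕ) + 1)))

/-- The multi-indexed Meixner-Pollaczek polynomial `P̌_{D,n}(x; λ)`, defined through the
`(M+1)×(M+1)` determinant whose first `M` columns are `ξ̌_{d_k}(x_j^{(M+1)})` and whose last
column is `r_j(x_j^{(M+1)}; λ, M+1) P̌_n(x_j^{(M+1)})`, multiplied by `i^{M(M+1)/2}`. -/
noncomputable def PD (a φ : ℝ) {M : ℕ} (d : Fin M → ℕ) (n : ℕ) (x : ℂ) : ℂ :=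
  Complex.I ^ (M * (M + 1) / 2) *
    Matrix.det (Matrix.of fun j k : Fin (M + 1) =>
      if h : (k : ℕ) < M then MP (1 - a) φ (d ⟨k, h⟩) (xS x (M + 1) ((j : ℕ) + 1))
      else rMP a (M + 1) ((j : ℕ) + 1) x * MP a φ n (xS x (M + 1) ((j : ℕ) + 1)))

/-- `ℓ_D = Σ_j d_j − M(M−1)/2`. -/
noncomputable def lD (M : ℕ) (d : Fin M → ℕ) : ℤ :=
  (∑ j : Fin M, (d j : ℤ)) - (M * (M - 1) / 2 : ℕ)

/-- Leading coefficient `c^Ξ_D = ∏_j c_{d_j}(t(λ)) · ∏_{j<k}(d_k − d_j)` of `Ξ_D`,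
where `c_m = (2 sin φ)^m/m!`. -/
noncomputable def cXiD (φ : ℝ) (M : ℕ) (d : Fin M → ℕ) : ℂ :=
  (∏ j : Fin M, (2 * (Real.sin φ : ℂ)) ^ (d j) / ((d j).factorial : ℂ)) *
    ∏ j : Fin M, ∏ k ∈ Finset.Ioi j, ((d k : ℂ) - (d j : ℂ))

/-- Leading coefficient `c^P_{D,n} = c^Ξ_D · c_n · ∏_j(−2a−n+d_j+1)` of `P_{D,n}`. -/
noncomputable def cPD (a φ : ℝ) (M : ℕ) (d : Fin M → ℕ) (n : ℕ) : ℂ :=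
  cXiD φ M d * (2 * (Real.sin φ : ℂ)) ^ n / (n.factorial : ℂ) *
    ∏ j : Fin M, (-2 * (a : ℂ) - n + d j + 1)

lemma aux_poch_succ (z : ℂ) (n : ℕ) : poch z (n + 1) = poch z n * (z + n) := by
  unfold poch; exact ascPochhammer_succ_eval n z

lemma aux_poch_zero (z : ℂ) : poch z 0 = 1 := by simp [poch]

lemma aux_poch_left (z : ℂ) (n : ℕ) : poch z (n + 1) = z * poch (z + 1) n := by
  unfold poch; rw [ascPochhammer_succ_left]; simp

lemma aux_poch_neg {k n : ℕ} (h : k < n) : poch (-(k : ℂ)) n = 0 := by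
  unfold poch; exact ascPochhammer_eval_neg_coe_nat_of_lt h

/-- `(z-M)_M = (-1)^M (1-z)_M` -/
lemma aux_poch_refl (z : ℂ) (M : ℕ) : poch (z - M) M = (-1) ^ M * poch (1 - z) M := by
  induction M generalizing z with
  | zero => simp [aux_poch_zero]
  | succ M ih =>
    rw [aux_poch_left, aux_poch_succ]
    have : z - ((M + 1 : ℕ) : ℂ) + 1 = z - M := by push_cast; ring
    rw [this, ih]; push_cast; ring

lemma aux_sum (f : ℕ → ℂ) (d M : ℕ) (h1 : ∀ l, d < l → f l = 0) (h2 : ∀ l, M ≤ l → f l = 0) :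
    ∑ l ∈ range (d + 1), f l = ∑ l : Fin M, f l := by
  rw [Fin.sum_univ_eq_sum_range f M]
  have e1 : ∑ l ∈ range (d + 1), f l = ∑ l ∈ range (d + 1 + M), f l := by
    apply sum_subset
    · intro x; simp; omega
    · intro x _ h; apply h1; simp at h; omega
  have e2 : ∑ l ∈ range M, f l = ∑ l ∈ range (d + 1 + M), f l := by
    apply sum_subset
    · intro x; simp; omega
    · intro x _ h; apply h2; simp at h; omega
  rw [e1, e2]

lemma aux_vand_id (M : ℕ) :
    (Matrix.vandermonde fun j : Fin M => (j : ℂ)).det = ∏ l : Fin M, ((l : ℕ).factorial : ℂ) := by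
  cases M with
  | zero => simp
  | succ m =>
    rw [Matrix.det_vandermonde_id_eq_superFactorial, ← Nat.prod_range_succ_factorial,
      ← Fin.prod_univ_eq_prod_range]
    push_cast; rfl

lemma aux_detW (M : ℕ) (c : ℂ) :
    (Matrix.of fun j l : Fin M => poch ((j : ℂ) - c) l).det
      = ∏ l : Fin M, ((l : ℕ).factorial : ℂ) := by
  rw [← aux_vand_id, ← Matrix.det_vandermonde_sub _ c,
    Matrix.det_eval_matrixOfPolynomials_eq_det_vandermonde _
      (fun l : Fin M => ascPochhammer ℂ l) (fun l => ascPochhammer_natDegree _ _)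
      (fun l => monic_ascPochhammer _ _)]
  rfl

lemma aux_detV (M : ℕ) (d : Fin M → ℕ) :
    (Matrix.of fun l k : Fin M => poch (-(d k : ℂ)) l).det
      = (∏ l : Fin M, (-1 : ℂ) ^ (l : ℕ)) *
        ∏ j : Fin M, ∏ k ∈ Finset.Ioi j, ((d k : ℂ) - (d j : ℂ)) := by
  rw [← Matrix.det_vandermonde,
    Matrix.det_eval_matrixOfPolynomials_eq_det_vandermonde _
      (fun l : Fin M => descPochhammer ℂ l) (fun l => descPochhammer_natDegree _ _)
      (fun l => monic_descPochhammer _ _), ← Matrix.det_transpose, ← Matrix.det_mul_row]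
  congr 1
  ext i j
  simp [poch, ascPochhammer_eval_neg_eq_descPochhammer]

lemma aux_MP1 (a φ : ℝ) (M : ℕ) (d : ℕ) (j : Fin M) (x : ℂ)
    (hx : ((1 - a : ℝ) : ℂ) + Complex.I * x = (j : ℂ) - ((M : ℂ) - 1)) :
    MP (1 - a) φ d x =
      (poch (2 - 2 * (a : ℂ)) d / (d.factorial : ℂ) * Complex.exp ((d : ℂ) * (φ : ℂ) * Complex.I)) *
      ∑ l : Fin M, poch ((j : ℂ) - ((M : ℂ) - 1)) l *
        (((1 - Complex.exp (-(2 * (φ : ℂ) * Complex.I))) ^ (l : ℕ) /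
        (poch (2 - 2 * (a : ℂ)) l * ((l : ℕ).factorial : ℂ))) * poch (-(d : ℂ)) l) := by
  unfold MP
  rw [hx]
  have h2 : 2 * ((1 - a : ℝ) : ℂ) = 2 - 2 * (a : ℂ) := by push_cast; ring
  have hj : (j : ℂ) - ((M : ℂ) - 1) = -((M - 1 - (j : ℕ) : ℕ) : ℂ) := by
    rw [Nat.sub_sub, Nat.cast_sub (by omega)]; push_cast; ring
  rw [h2, aux_sum _ d M]
  · congr 1
    apply sum_congr rfl
    intro l _
    ring
  · intro l hl; rw [aux_poch_neg hl]; simp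
  · intro l hl; rw [hj, aux_poch_neg (k := M - 1 - (j : ℕ)) (n := l) (by omega)]; simp

lemma aux_MP2 (a φ : ℝ) (ha : 0 < a) (n : ℕ) (x : ℂ)
    (hx : (a : ℂ) + Complex.I * x = 2 * a) :
    MP a φ n x = poch (2 * (a : ℂ)) n / (n.factorial : ℂ) *
      Complex.exp (-((n : ℂ) * (φ : ℂ) * Complex.I)) := by
  unfold MP
  rw [hx, mul_assoc]
  have hp : ∀ k, poch (2 * (a : ℂ)) k ≠ 0 := by
    intro k
    have := (ascPochhammer_pos k (2 * a) (by positivity)).ne'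
    have h : poch (2 * (a : ℂ)) k = (((ascPochhammer ℝ k).eval (2 * a) : ℝ) : ℂ) := by
      unfold poch
      have := ascPochhammer_eval₂ (Complex.ofRealHom) k (2 * a : ℂ)
      rw [this, show (2 * a : ℂ) = Complex.ofRealHom (2 * a) by simp, Polynomial.eval₂_at_apply]
      rfl
    rw [h]; exact_mod_cast this
  have key : ∑ k ∈ Finset.range (n + 1),
      poch (-(n : ℂ)) k * poch (2 * (a : ℂ)) k /
        (poch (2 * (a : ℂ)) k * (k.factorial : ℂ)) *
        (1 - Complex.exp (-(2 * (φ : ℂ) * Complex.I))) ^ k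
      = (Complex.exp (-(2 * (φ : ℂ) * Complex.I))) ^ n := by
    set q := Complex.exp (-(2 * (φ : ℂ) * Complex.I))
    have : q ^ n = ((q - 1) + 1) ^ n := by ring
    rw [this, add_pow]
    apply sum_congr rfl
    intro k hk
    have hc : poch (-(n : ℂ)) k = (-1) ^ k * (k.factorial * n.choose k : ℂ) := by
      unfold poch
      rw [ascPochhammer_eval_neg_eq_descPochhammer, descPochhammer_eval_eq_descFactorial,
        Nat.descFactorial_eq_factorial_mul_choose]
      push_cast; rfl
    have := hp k
    have hf : (k.factorial : ℂ) ≠ 0 := by exact_mod_cast k.factorial_ne_zero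
    rw [hc, one_pow, ← neg_sub q 1, neg_pow (q - 1)]
    have h1 : ((-1 : ℂ) ^ k) * (-1) ^ k = 1 := by rw [← mul_pow]; simp
    field_simp
    linear_combination (q - 1) ^ k * (n.choose k : ℂ) * h1
  rw [key, ← Complex.exp_nat_mul, ← Complex.exp_add]
  congr 2
  ring

lemma aux_det_minor (a φ : ℝ) (M : ℕ) (d : Fin M → ℕ) (x : Fin M → ℂ)
    (hx : ∀ j : Fin M, ((1 - a : ℝ) : ℂ) + Complex.I * x j = (j : ℂ) - ((M : ℂ) - 1)) :
    (Matrix.of fun j k : Fin M => MP (1 - a) φ (d k) (x j)).det =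
      (∏ k : Fin M, (poch (2 - 2 * (a : ℂ)) (d k) / ((d k).factorial : ℂ) *
        Complex.exp ((d k : ℂ) * (φ : ℂ) * Complex.I))) *
      ((∏ l : Fin M, ((l : ℕ).factorial : ℂ)) *
      ((∏ l : Fin M, ((1 - Complex.exp (-(2 * (φ : ℂ) * Complex.I))) ^ (l : ℕ) /
        (poch (2 - 2 * (a : ℂ)) l * ((l : ℕ).factorial : ℂ)))) *
      ((∏ l : Fin M, (-1 : ℂ) ^ (l : ℕ)) *
        ∏ j : Fin M, ∏ k ∈ Finset.Ioi j, ((d k : ℂ) - (d j : ℂ))))) := by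
  rw [← aux_detV, ← aux_detW M ((M : ℂ) - 1), ← Matrix.det_mul_column, ← Matrix.det_mul,
    ← Matrix.det_mul_row]
  congr 1
  ext j k
  rw [Matrix.of_apply, aux_MP1 a φ M (d k) j (x j) (hx j)]
  simp [Matrix.mul_apply]

lemma aux_PD (a φ : ℝ) (ha : 0 < a) (M : ℕ) (d : Fin M → ℕ) (n : ℕ) :
    PD a φ d n (-Complex.I * ((a : ℂ) - (M : ℂ) / 2)) =
    Complex.I ^ (M * (M + 1) / 2) * (((-1) ^ M * Complex.I ^ (-(M : ℤ)) *
      ((-1) ^ M * poch (1 - 2 * (a : ℂ)) M) * (poch (2 * (a : ℂ)) n / (n.factorial : ℂ) *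
      Complex.exp (-((n : ℂ) * (φ : ℂ) * Complex.I)))) * 
      ((∏ k : Fin M, (poch (2 - 2 * (a : ℂ)) (d k) / ((d k).factorial : ℂ) *
        Complex.exp ((d k : ℂ) * (φ : ℂ) * Complex.I))) *
      ((∏ l : Fin M, ((l : ℕ).factorial : ℂ)) *
      ((∏ l : Fin M, ((1 - Complex.exp (-(2 * (φ : ℂ) * Complex.I))) ^ (l : ℕ) /
        (poch (2 - 2 * (a : ℂ)) l * ((l : ℕ).factorial : ℂ)))) *
      ((∏ l : Fin M, (-1 : ℂ) ^ (l : ℕ)) *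
        ∏ j : Fin M, ∏ k ∈ Finset.Ioi j, ((d k : ℂ) - (d j : ℂ))))))) := by
  unfold PD
  congr 1
  set x : ℂ := -Complex.I * ((a : ℂ) - (M : ℂ) / 2) with hx
  have hIx : Complex.I * x = a - M / 2 := by
    rw [hx]; linear_combination (-((a : ℂ) - M / 2)) * Complex.I_mul_I
  have hxS : ∀ j : ℕ, Complex.I * xS x (M + 1) (j + 1) = a - M + j := by
    intro j
    unfold xS
    rw [mul_add, hIx]; push_cast
    linear_combination (((M : ℂ) + 1 + 1) / 2 - (j + 1)) * Complex.I_mul_I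
  rw [← aux_det_minor a φ M d (fun j => xS x (M + 1) ((j : ℕ) + 1))
    (by intro j; rw [hxS]; push_cast; ring), Matrix.det_succ_column _ (Fin.last M),
    Finset.sum_eq_single (Fin.last M)]
  · have hr : rMP a (M + 1) (M + 1) x =
        (-1) ^ M * Complex.I ^ (-(M : ℤ)) * ((-1) ^ M * poch (1 - 2 * (a : ℂ)) M) := by
      unfold rMP
      rw [hIx]
      rw [← aux_poch_refl]
      have e1 : (a : ℂ) - (((M + 1 : ℕ) : ℂ) - 1) / 2 + (a - M / 2) = 2 * a - M := by
        push_cast; ring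
      have e2 : (1 : ℤ) - ((M + 1 : ℕ) : ℤ) = -(M : ℤ) := by push_cast; ring
      rw [e1, e2]
      simp [aux_poch_zero]
    have hs : ((-1 : ℂ)) ^ ((Fin.last M : ℕ) + (Fin.last M : ℕ)) = 1 := by
      rw [← two_mul, pow_mul]; simp
    rw [hs, one_mul, Matrix.of_apply, dif_neg (by simp), Fin.val_last, hr,
      aux_MP2 a φ ha n _ (by rw [hxS]; ring)]
    congr 2
    ext j k
    simp
  · intro i _ hi
    have hi' : (i : ℕ) < M := by
      have := i.2
      have : (i : ℕ) ≠ M := fun h => hi (Fin.ext h)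
      omega
    have : rMP a (M + 1) ((i : ℕ) + 1) x = 0 := by
      unfold rMP
      rw [hIx]
      have e1 : (a : ℂ) - (((M + 1 : ℕ) : ℂ) - 1) / 2 - (a - M / 2) = -((0 : ℕ) : ℂ) := by
        push_cast; ring
      rw [e1, aux_poch_neg (by omega)]; simp
    rw [Matrix.of_apply, dif_neg (by simp), this]
    simp
  · simp

lemma aux_tri (M : ℕ) : M * (M + 1) / 2 = M * (M - 1) / 2 + M := by
  have h1 := Finset.sum_range_id M
  have h2 := Finset.sum_range_id (M + 1)
  rw [Finset.sum_range_succ, h1] at h2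
  rw [h2]; simp [mul_comm]

lemma aux_prod_pow (M : ℕ) (c : ℂ) : ∏ l : Fin M, c ^ (l : ℕ) = c ^ (M * (M - 1) / 2) := by
  rw [Finset.prod_pow_eq_pow_sum, Fin.sum_univ_eq_sum_range (fun i => i) M, Finset.sum_range_id]

lemma aux_prodB (u : ℂ) (M : ℕ) :
    poch u M * ∏ j : Fin M, poch u (j : ℕ) = u ^ M * ∏ j : Fin M, poch (u + 1) (j : ℕ) := by
  have h : u ^ M * ∏ j : Fin M, poch (u + 1) (j : ℕ) = ∏ j : Fin M, poch u ((j : ℕ) + 1) := by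
    simp_rw [aux_poch_left]
    rw [Finset.prod_mul_distrib]; simp
  rw [h, Fin.prod_univ_eq_prod_range (fun j => poch u j), 
    Fin.prod_univ_eq_prod_range (fun j => poch u (j + 1))]
  have h1 := Finset.prod_range_succ (fun j => poch u j) M
  have h2 := Finset.prod_range_succ' (fun j => poch u j) M
  rw [aux_poch_zero, mul_one] at h2
  rw [← h2, h1, mul_comm]

lemma aux_poch_mono {u : ℂ} {m n : ℕ} (h : m ≤ n) (h0 : poch u m = 0) : poch u n = 0 := by
  induction n, h using Nat.le_induction with
  | base => exact h0
  | succ k _ ih => rw [aux_poch_succ, ih, zero_mul]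

lemma aux_core (u : ℂ) (M : ℕ) (d : Fin M → ℕ) (hd : StrictMono d)
    (h0 : ∀ j : Fin M, poch u (j : ℕ) ≠ 0) :
    poch u M * ((∏ k, poch (u + 1) (d k)) / ∏ l : Fin M, poch (u + 1) (l : ℕ)) =
      (∏ j : Fin M, poch u (d j) / poch u (j : ℕ)) * ∏ j : Fin M, (u + d j) := by
  have hA : (∏ j : Fin M, poch u (d j) / poch u (j : ℕ)) * ∏ j : Fin M, (u + d j) =
      (u ^ M * ∏ k, poch (u + 1) (d k)) / ∏ j : Fin M, poch u (j : ℕ) := by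
    rw [Finset.prod_div_distrib, div_mul_eq_mul_div, ← Finset.prod_mul_distrib]
    simp_rw [← aux_poch_succ, aux_poch_left]
    rw [Finset.prod_mul_distrib]; simp
  have hP : ∏ j : Fin M, poch u (j : ℕ) ≠ 0 := Finset.prod_ne_zero_iff.2 fun j _ => h0 j
  by_cases hM : poch u M = 0
  · rw [hM, zero_mul, ← zero_div (∏ j : Fin M, poch u (j : ℕ)), hA]
    congr 1
    cases M with
    | zero => simp [aux_poch_zero] at hM
    | succ m =>
      have hle : m ≤ d (Fin.last m) := by
        have key : ∀ i : ℕ, ∀ h : i < m + 1, i ≤ d ⟨i, h⟩ := by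
          intro i
          induction i with
          | zero => intro _; exact Nat.zero_le _
          | succ i ih =>
            intro h
            have h1 := ih (by omega)
            have h2 : d ⟨i, by omega⟩ < d ⟨i + 1, h⟩ := hd (by simp [Fin.lt_def])
            omega
        exact key m (by omega)
      have hz : u * poch (u + 1) (d (Fin.last m)) = 0 := by
        rw [← aux_poch_left]; exact aux_poch_mono (by omega) hM
      rw [pow_succ, Fin.prod_univ_castSucc]
      linear_combination (-u ^ m * ∏ i : Fin m, poch (u + 1) (d i.castSucc)) * hz
  · have hB := aux_prodB u M
    have hQ : ∏ l : Fin M, poch (u + 1) (l : ℕ) ≠ 0 := by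
      intro h
      rw [h, mul_zero] at hB
      exact (mul_ne_zero hM hP) hB
    rw [hA, ← mul_div_assoc, div_eq_div_iff hQ hP]
    linear_combination (∏ k, poch (u + 1) (d k)) * hB

lemma aux_poch_real (r : ℝ) (k : ℕ) :
    poch (r : ℂ) k = (((ascPochhammer ℝ k).eval r : ℝ) : ℂ) := by
  unfold poch
  have := ascPochhammer_eval₂ (Complex.ofRealHom) k (r : ℂ)
  rw [this, show (r : ℂ) = Complex.ofRealHom r by simp, Polynomial.eval₂_at_apply]
  rfl

lemma aux_z (φ : ℝ) : 1 - Complex.exp (-(2 * (φ : ℂ) * Complex.I)) =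
    Complex.I * (2 * (Real.sin φ : ℂ)) * (Complex.exp (Complex.I * φ))⁻¹ := by
  rw [Complex.ofReal_sin, Complex.sin, ← Complex.exp_neg]
  have h1 : Complex.exp (-(2 * (φ : ℂ) * Complex.I)) =
    Complex.exp (-(Complex.I * φ)) * Complex.exp (-(Complex.I * φ)) := by
    rw [← Complex.exp_add]; congr 1; ring
  have h2 : Complex.exp (φ * Complex.I) * Complex.exp (-(Complex.I * φ)) = 1 := by
    rw [← Complex.exp_add]; simp [mul_comm]
  have h3 : Complex.exp (-φ * Complex.I) = Complex.exp (-(Complex.I * φ)) := by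
    congr 1; ring
  rw [h1, h3]
  linear_combination (-1 : ℂ) * h2 + (Complex.exp (-(Complex.I * φ)) -
    Complex.exp (φ * Complex.I)) * Complex.exp (-(Complex.I * φ)) * (-1) * Complex.I_mul_I

/-- Value of the multi-indexed Meixner-Pollaczek polynomial at the special point
`η₀ = x₀ = -i(a - M/2)`. -/
theorem PD_special_value (a φ : ℝ) (ha : 0 < a) (hφ1 : 0 < φ) (hφ2 : φ < Real.pi)
    (M : ℕ) (d : Fin M → ℕ) (hd : StrictMono d) (n : ℕ)
    (hden : ∀ j : Fin M, ((d j : ℝ) + 1 - n - 2 * a) ≠ 0)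
    (hden' : ∀ j : Fin M, (ascPochhammer ℝ (j : ℕ)).eval (1 - 2 * a) ≠ 0) :
    PD a φ d n (-Complex.I * ((a : ℂ) - (M : ℂ) / 2)) =
      cPD a φ M d n * Complex.exp (Complex.I * (φ : ℂ) * ((lD M d : ℂ) - (n : ℂ))) *
        (poch (2 * (a : ℂ)) n / (2 * (Real.sin φ : ℂ)) ^ (lD M d + n)) *
        (∏ j : Fin M, poch (1 - 2 * (a : ℂ)) (d j) / poch (1 - 2 * (a : ℂ)) (j : ℕ)) *
        ∏ j : Fin M, ((d j : ℂ) + 1 - 2 * (a : ℂ)) / ((d j : ℂ) + 1 - n - 2 * (a : ℂ)) := by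
  have hS : (2 * (Real.sin φ : ℂ)) ≠ 0 := by
    have := (Real.sin_pos_of_pos_of_lt_pi hφ1 hφ2).ne'
    exact mul_ne_zero two_ne_zero (by exact_mod_cast this)
  have hE : Complex.exp (Complex.I * φ) ≠ 0 := Complex.exp_ne_zero _
  have hcore := aux_core (1 - 2 * (a : ℂ)) M d hd (by
    intro j h
    apply hden' j
    have h2 := aux_poch_real (1 - 2 * a) j
    push_cast at h2
    rw [h] at h2
    exact_mod_cast h2.symm)
  rw [show (1 : ℂ) - 2 * a + 1 = 2 - 2 * a by ring] at hcore
  have hD : (∏ j : Fin M, (-2 * (a : ℂ) - n + d j + 1)) *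
      ∏ j : Fin M, ((d j : ℂ) + 1 - 2 * (a : ℂ)) / ((d j : ℂ) + 1 - n - 2 * (a : ℂ)) =
      ∏ j : Fin M, (1 - 2 * (a : ℂ) + d j) := by
    rw [← Finset.prod_mul_distrib]
    apply Finset.prod_congr rfl
    intro j _
    have h : ((d j : ℂ) + 1 - n - 2 * (a : ℂ)) ≠ 0 := by exact_mod_cast hden j
    rw [show -2 * (a : ℂ) - n + d j + 1 = (d j : ℂ) + 1 - n - 2 * (a : ℂ) by ring,
      mul_div_cancel₀ _ h]
    ring
  rw [aux_PD a φ ha M d n]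
  unfold cPD cXiD
  rw [aux_z]
  simp only [Finset.prod_div_distrib, Finset.prod_mul_distrib, aux_prod_pow] at hcore hD ⊢
  have hF : ∏ l : Fin M, ((l : ℕ).factorial : ℂ) ≠ 0 :=
    Finset.prod_ne_zero_iff.2 fun j _ => by exact_mod_cast (Nat.factorial_ne_zero _)
  have hI : Complex.I ^ (M * (M + 1) / 2) * Complex.I ^ (-(M : ℤ)) =
      Complex.I ^ (M * (M - 1) / 2) := by
    rw [aux_tri, pow_add, zpow_neg, zpow_natCast, mul_assoc,
      mul_inv_cancel₀ (pow_ne_zero _ Complex.I_ne_zero), mul_one]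
  have hEd : ∏ k : Fin M, Complex.exp ((d k : ℂ) * (φ : ℂ) * Complex.I) =
      Complex.exp (Complex.I * φ) ^ (∑ k, d k) := by
    rw [← Finset.prod_pow_eq_pow_sum]
    apply Finset.prod_congr rfl
    intro k _
    rw [← Complex.exp_nat_mul]; congr 1; ring
  have hEn : Complex.exp (-((n : ℂ) * (φ : ℂ) * Complex.I)) =
      (Complex.exp (Complex.I * φ) ^ n)⁻¹ := by
    rw [← Complex.exp_nat_mul, ← Complex.exp_neg]; congr 1; ring
  have hlE : Complex.exp (Complex.I * (φ : ℂ) * ((lD M d : ℂ) - (n : ℂ))) =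
      Complex.exp (Complex.I * φ) ^ (∑ k, d k) *
      (Complex.exp (Complex.I * φ) ^ (M * (M - 1) / 2))⁻¹ *
      (Complex.exp (Complex.I * φ) ^ n)⁻¹ := by
    simp only [← Complex.exp_nat_mul, ← Complex.exp_neg, ← Complex.exp_add]
    congr 1
    unfold lD
    generalize M * (M - 1) / 2 = T
    push_cast
    ring
  have hlS : (2 * (Real.sin φ : ℂ)) ^ (lD M d + n) =
      (2 * (Real.sin φ : ℂ)) ^ (∑ k, d k) * ((2 * (Real.sin φ : ℂ)) ^ (M * (M - 1) / 2))⁻¹ *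
      (2 * (Real.sin φ : ℂ)) ^ n := by
    unfold lD
    rw [zpow_add₀ hS, zpow_sub₀ hS, ← Nat.cast_sum]
    simp only [zpow_natCast, div_eq_mul_inv]
  rw [hEd, hEn, hlE, hlS, Finset.prod_pow_eq_pow_sum, mul_pow, mul_pow (Complex.I)]
  have hm : ((-1 : ℂ) ^ M) * (-1) ^ M = 1 := by rw [← mul_pow]; simp
  have hIT : Complex.I ^ (M * (M - 1) / 2) * Complex.I ^ (M * (M - 1) / 2) *
      (-1) ^ (M * (M - 1) / 2) = 1 := by
    rw [← mul_pow, ← mul_pow]; simp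
  have hnf : (n.factorial : ℂ) ≠ 0 := by exact_mod_cast n.factorial_ne_zero
  have hdf : ∏ l : Fin M, ((d l).factorial : ℂ) ≠ 0 :=
    Finset.prod_ne_zero_iff.2 fun j _ => by exact_mod_cast (Nat.factorial_ne_zero _)
  generalize Complex.I ^ (M * (M + 1) / 2) = i1 at *
  generalize Complex.I ^ (-(M : ℤ)) = i2 at *
  generalize Complex.I ^ (M * (M - 1) / 2) = i3 at *
  generalize (-1 : ℂ) ^ (M * (M - 1) / 2) = m1 at *
  generalize (-1 : ℂ) ^ M = m2 at *
  generalize 2 * (Real.sin φ : ℂ) = S at *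
  generalize Complex.exp (Complex.I * φ) = E at *
  generalize M * (M - 1) / 2 = T at *
  generalize ∑ k, d k = N at *
  generalize ∏ j : Fin M, ∏ k ∈ Finset.Ioi j, ((d k : ℂ) - (d j : ℂ)) = V at *
  generalize ∏ l : Fin M, ((l : ℕ).factorial : ℂ) = F at *
  generalize ∏ l : Fin M, ((d l).factorial : ℂ) = G at *
  generalize ∏ l : Fin M, poch (2 - 2 * (a : ℂ)) (l : ℕ) = Q at *
  generalize ∏ l : Fin M, poch (2 - 2 * (a : ℂ)) (d l) = R at *
  generalize ∏ l : Fin M, poch (1 - 2 * (a : ℂ)) (l : ℕ) = U at *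
  generalize ∏ l : Fin M, poch (1 - 2 * (a : ℂ)) (d l) = W at *
  generalize (n.factorial : ℂ) = nf at *
  generalize poch (2 * (a : ℂ)) n = p at *
  generalize poch (1 - 2 * (a : ℂ)) M = q at *
  rw [← hD] at hcore
  generalize (∏ j : Fin M, (-2 * (a : ℂ) - n + d j + 1)) = D1 at *
  generalize (∏ j : Fin M, ((d j : ℂ) + 1 - 2 * (a : ℂ))) = D2 at *
  generalize (∏ j : Fin M, ((d j : ℂ) + 1 - n - 2 * (a : ℂ))) = D3 at *
  have hST : S ^ T ≠ 0 := pow_ne_zero _ hS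
  have hSN : S ^ N ≠ 0 := pow_ne_zero _ hS
  have hSn : S ^ n ≠ 0 := pow_ne_zero _ hS
  have hET : (E⁻¹) ^ T = (E ^ T)⁻¹ := inv_pow _ _
  rw [hET]
  generalize S ^ T = ST at *
  generalize S ^ N = SN at *
  generalize S ^ n = Sn at *
  generalize (E ^ T)⁻¹ = ET at *
  generalize E ^ N = EN at *
  generalize (E ^ n)⁻¹ = En at *
  have hL : i1 * (m2 * i2 * (m2 * q) * (p / nf * En) *
      (R / G * EN * (F * (i3 * ST * ET / (Q * F) * (m1 * V))))) =
      (i1 * i2 * i3 * m1) * (m2 * m2) * (q * (R / Q)) * (F * F⁻¹) *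
        (p / nf * En * EN * ST * ET * V / G) := by
    simp only [div_eq_mul_inv, mul_inv]; ring
  have hR : SN / G * V * Sn / nf * D1 * (EN * ET * En) * (p / (SN * ST⁻¹ * Sn)) * (W / U) *
      (D2 / D3) = (W / U * (D1 * (D2 / D3))) * (SN * SN⁻¹) * (Sn * Sn⁻¹) *
        (p / nf * En * EN * ST * ET * V / G) := by
    simp only [div_eq_mul_inv, mul_inv, inv_inv]; ring
  rw [hL, hR, hI, hIT, hm, hcore, mul_inv_cancel₀ hF, mul_inv_cancel₀ hSN, mul_inv_cancel₀ hSn]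
  ring
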